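/- arXiv:1902.08363 — 2 statements merged into one kernel-verified Lean document; each statement's English description precedes it below -/
import Mathlib

section
/- For every α ∈ (1,2) and every positive integer M, the symmetric matrix G_α + G_αᵀ is negative definite; that is, uᵀ(G_α + G_αᵀ)u < 0 for every nonzero vector u ∈ ℝ^M. -/
open Matrix

/-- The Grünwald–Letnikov coefficients `g_k^{(α)}`. -/
noncomputable def gcoef (α : ℝ) : ℕ → ℝ
  | 0 => 1
  | (k+1) => (1 - (α + 1) / (k + 1 : ℕ)) * gcoef α k

/-- The WSGD coefficients `w_k^{(α)}`. -/
noncomputable def wcoef (α : ℝ) : ℕ → ℝ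
  | 0 => α / 2 * gcoef α 0
  | (k+1) => α / 2 * gcoef α (k+1) + (2 - α) / 2 * gcoef α k

/-- The `M × M` lower-Hessenberg Toeplitz matrix `G_α` whose `(i,j)` entry (1-based)
equals `w_{i-j+1}^{(α)}` if `i - j + 1 ≥ 0` and `0` otherwise. -/
noncomputable def Gmat (α : ℝ) (M : ℕ) : Matrix (Fin M) (Fin M) ℝ :=
  Matrix.of fun i j => if (j : ℕ) ≤ (i : ℕ) + 1 then wcoef α ((i : ℕ) + 1 - (j : ℕ)) else 0

open Finset in
/-- Each coefficient is a negative multiple of the preceding partial sum. -/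
lemma gcoef_succ_eq_neg_mul_sum (α : ℝ) (n : ℕ) :
    gcoef α (n + 1) = -(α / (n + 1)) * ∑ k ∈ range (n + 1), gcoef α k := by
  induction n with
  | zero => simp [gcoef]
  | succ n ih =>
    rw [sum_range_succ]
    have hn : (n : ℝ) + 1 ≠ 0 := by positivity
    have hn' : (n : ℝ) + 1 + 1 ≠ 0 := by positivity
    generalize ∑ k ∈ range (n + 1), gcoef α k = s at ih ⊢
    rw [gcoef, ih]
    push_cast
    field_simp
    ring

open Finset in
/-- The partial sums of the Grünwald–Letnikov coefficients, from the second one on, are negative. -/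
lemma sum_gcoef_neg {α : ℝ} (hα : α ∈ Set.Ioo (1 : ℝ) 2) (n : ℕ) :
    ∑ k ∈ range (n + 2), gcoef α k < 0 := by
  obtain ⟨h1, h2⟩ := hα
  induction n with
  | zero => simpa [sum_range_succ, gcoef] using h1
  | succ n ih =>
    rw [sum_range_succ, gcoef_succ_eq_neg_mul_sum]
    push_cast
    have hn : α / ((n : ℝ) + 1 + 1) < 1 := by
      rw [div_lt_one (by positivity)]
      linarith [(n.cast_nonneg : (0 : ℝ) ≤ n)]
    nlinarith

lemma gcoef_pos {α : ℝ} (hα : α ∈ Set.Ioo (1 : ℝ) 2) (n : ℕ) : 0 < gcoef α (n + 2) := by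
  rw [gcoef_succ_eq_neg_mul_sum]
  have h : 0 < α / ((n + 1 : ℕ) + 1 : ℝ) := div_pos (by linarith [hα.1]) (by positivity)
  exact mul_pos_of_neg_of_neg (neg_neg_of_pos h) (sum_gcoef_neg hα n)

lemma wcoef_pos {α : ℝ} (hα : α ∈ Set.Ioo (1 : ℝ) 2) (n : ℕ) : 0 < wcoef α (n + 3) := by
  obtain ⟨h1, h2⟩ := hα
  exact add_pos (mul_pos (by linarith) (gcoef_pos ⟨h1, h2⟩ (n + 1)))
    (mul_pos (by linarith) (gcoef_pos ⟨h1, h2⟩ n))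

lemma wcoef_one_neg {α : ℝ} (hα : α ∈ Set.Ioo (1 : ℝ) 2) : wcoef α 1 < 0 := by
  obtain ⟨h1, h2⟩ := hα
  simp only [wcoef, gcoef]
  norm_num
  nlinarith

lemma wcoef_zero_add_two_pos {α : ℝ} (hα : α ∈ Set.Ioo (1 : ℝ) 2) :
    0 < wcoef α 0 + wcoef α 2 := by
  obtain ⟨h1, h2⟩ := hα
  have h : wcoef α 0 + wcoef α 2 = α * (α + 2) * (α - 1) / 4 := by
    simp only [wcoef, gcoef]
    push_cast
    ring
  rw [h]
  have : 0 < α - 1 := by linarith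
  positivity

open Finset in
lemma sum_wcoef (α : ℝ) (n : ℕ) :
    ∑ k ∈ range (n + 1), wcoef α k =
      α / 2 * ∑ k ∈ range (n + 1), gcoef α k + (2 - α) / 2 * ∑ k ∈ range n, gcoef α k := by
  induction n with
  | zero => simp [wcoef]
  | succ n ih =>
    rw [sum_range_succ, ih, sum_range_succ _ (n + 1), sum_range_succ _ n, wcoef]
    ring

open Finset in
lemma sum_wcoef_neg {α : ℝ} (hα : α ∈ Set.Ioo (1 : ℝ) 2) (n : ℕ) :
    ∑ k ∈ range (n + 3), wcoef α k < 0 := by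
  rw [sum_wcoef]
  have h1 := sum_gcoef_neg hα (n + 1)
  have h2 := sum_gcoef_neg hα n
  obtain ⟨h3, h4⟩ := hα
  exact add_neg (mul_neg_of_pos_of_neg (by linarith) h1) (mul_neg_of_pos_of_neg (by linarith) h2)

/-- The entry of `G_α + G_αᵀ` at distance `d + 1` from the diagonal. -/
noncomputable def offDiagCoef (α : ℝ) : ℕ → ℝ
  | 0 => wcoef α 0 + wcoef α 2
  | (d+1) => wcoef α (d + 3)

lemma offDiagCoef_pos {α : ℝ} (hα : α ∈ Set.Ioo (1 : ℝ) 2) : ∀ d, 0 < offDiagCoef α d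
  | 0 => wcoef_zero_add_two_pos hα
  | d + 1 => wcoef_pos hα d

open Finset in
lemma wcoef_one_add_sum_offDiagCoef (α : ℝ) (m : ℕ) :
    wcoef α 1 + ∑ d ∈ range (m + 1), offDiagCoef α d = ∑ k ∈ range (m + 3), wcoef α k := by
  induction m with
  | zero =>
    simp [sum_range_succ, offDiagCoef]
    ring
  | succ m ih => rw [sum_range_succ, ← add_assoc, ih, sum_range_succ _ (m + 3), offDiagCoef]

open Finset in
lemma wcoef_one_add_sum_offDiagCoef_neg {α : ℝ} (hα : α ∈ Set.Ioo (1 : ℝ) 2) (m : ℕ) :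
    wcoef α 1 + ∑ d ∈ range m, offDiagCoef α d < 0 := by
  cases m with
  | zero => simpa using wcoef_one_neg hα
  | succ m =>
    rw [wcoef_one_add_sum_offDiagCoef]
    exact sum_wcoef_neg hα m

/-- The symmetric Toeplitz kernel whose finite sections are the matrices `G_α + G_αᵀ`. -/
noncomputable def symKernel (α : ℝ) (i j : ℕ) : ℝ :=
  (if j ≤ i + 1 then wcoef α (i + 1 - j) else 0) + if i ≤ j + 1 then wcoef α (j + 1 - i) else 0

lemma symKernel_comm (α : ℝ) (i j : ℕ) : symKernel α i j = symKernel α j i := add_comm _ _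

lemma symKernel_self (α : ℝ) (i : ℕ) : symKernel α i i = 2 * wcoef α 1 := by
  simp [symKernel, two_mul]

lemma symKernel_add (α : ℝ) (i d : ℕ) : symKernel α i (i + 1 + d) = offDiagCoef α d := by
  cases d with
  | zero => simp [symKernel, offDiagCoef, show i + 1 + 1 - i = 2 by omega,
      show i ≤ i + 1 + 1 by omega]
  | succ d =>
    simp [symKernel, offDiagCoef, show i + 1 + (d + 1) + 1 - i = d + 3 by omega,
      show i ≤ i + 1 + (d + 1) + 1 by omega]

lemma symKernel_pos {α : ℝ} (hα : α ∈ Set.Ioo (1 : ℝ) 2) {i j : ℕ} (hij : i ≠ j) :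
    0 < symKernel α i j := by
  wlog h : i < j generalizing i j
  · rw [symKernel_comm]
    exact this hij.symm (by omega)
  obtain ⟨d, rfl⟩ := Nat.exists_eq_add_of_le (Nat.succ_le_of_lt h)
  rw [Nat.succ_eq_add_one, symKernel_add]
  exact offDiagCoef_pos hα d

open Finset in
/-- The row sums of every finite section of `symKernel` are negative. -/
lemma sum_symKernel_neg {α : ℝ} (hα : α ∈ Set.Ioo (1 : ℝ) 2) {M i : ℕ} (hi : i < M) :
    ∑ j ∈ range M, symKernel α i j < 0 := by
  obtain ⟨r, rfl⟩ := Nat.exists_eq_add_of_le (Nat.succ_le_of_lt hi)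
  rw [Nat.succ_eq_add_one, sum_range_add, sum_range_succ, symKernel_self, ← sum_range_reflect]
  have hl : ∑ j ∈ range i, symKernel α i (i - 1 - j) = ∑ d ∈ range i, offDiagCoef α d := by
    refine sum_congr rfl fun d hd => ?_
    rw [symKernel_comm, ← symKernel_add α (i - 1 - d) d]
    congr 1
    have := mem_range.mp hd
    omega
  simp only [hl, symKernel_add]
  linarith [wcoef_one_add_sum_offDiagCoef_neg hα i, wcoef_one_add_sum_offDiagCoef_neg hα r]

/-- A symmetric matrix with nonnegative off-diagonal entries and negative row sums is negative
definite. -/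
lemma Matrix.dotProduct_mulVec_neg_of_rowSum_neg {ι : Type*} [Fintype ι] {A : Matrix ι ι ℝ}
    (hA : A.IsSymm) (hoff : ∀ i j, i ≠ j → 0 ≤ A i j) (hrow : ∀ i, ∑ j, A i j < 0)
    {u : ι → ℝ} (hu : u ≠ 0) : u ⬝ᵥ (A *ᵥ u) < 0 := by
  have hswap : ∑ i, ∑ j, A i j * u j ^ 2 = ∑ i, ∑ j, A i j * u i ^ 2 := by
    rw [Finset.sum_comm]
    simp only [hA.apply]
  calc u ⬝ᵥ (A *ᵥ u) = ∑ i, ∑ j, A i j * (u i * u j) := by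
        simp only [dotProduct, mulVec, Finset.mul_sum]
        exact Finset.sum_congr rfl fun i _ => Finset.sum_congr rfl fun j _ => by ring
    _ ≤ ∑ i, ∑ j, (A i j * u i ^ 2 + A i j * u j ^ 2) / 2 := by
        refine Finset.sum_le_sum fun i _ => Finset.sum_le_sum fun j _ => ?_
        rcases eq_or_ne i j with rfl | hij
        · exact le_of_eq (by ring)
        · nlinarith [mul_nonneg (hoff i j hij) (sq_nonneg (u i - u j))]
    _ = ∑ i, (∑ j, A i j) * u i ^ 2 := by
        simp only [← Finset.sum_div, Finset.sum_add_distrib, hswap, Finset.sum_mul]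
        ring
    _ < 0 := by
        obtain ⟨i, hi⟩ := Function.ne_iff.mp hu
        exact Finset.sum_neg' (fun j _ => mul_nonpos_of_nonpos_of_nonneg (hrow j).le (sq_nonneg _))
          ⟨i, Finset.mem_univ i, mul_neg_of_neg_of_pos (hrow i) (sq_pos_of_ne_zero hi)⟩

lemma Gmat_add_transpose_apply (α : ℝ) {M : ℕ} (i j : Fin M) :
    (Gmat α M + (Gmat α M)ᵀ) i j = symKernel α i j := rfl

/-- For every `α ∈ (1,2)` and every positive integer `M`, the symmetric matrix
`G_α + G_αᵀ` is negative definite: `uᵀ (G_α + G_αᵀ) u < 0` for every nonzero `u ∈ ℝ^M`. -/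
theorem Gmat_add_transpose_negDef (α : ℝ) (hα : α ∈ Set.Ioo (1 : ℝ) 2)
    (M : ℕ) (hM : 0 < M) (u : Fin M → ℝ) (hu : u ≠ 0) :
    u ⬝ᵥ ((Gmat α M + (Gmat α M)ᵀ) *ᵥ u) < 0 := by
  refine Matrix.dotProduct_mulVec_neg_of_rowSum_neg (Matrix.isSymm_add_transpose_self _)
    (fun i j hij => ?_) (fun i => ?_) hu
  · rw [Gmat_add_transpose_apply]
    exact (symKernel_pos hα (Fin.val_ne_of_ne hij)).le
  · simp only [Gmat_add_transpose_apply]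
    rw [Fin.sum_univ_eq_sum_range (symKernel α i) M]
    exact sum_symKernel_neg hα i.isLt
end

section
/- Let d be a function on (x_L, x_R) with 0 ≤ κ_min ≤ d(x) ≤ κ_max < ∞ for all x, and suppose d is either concave or convex on (x_L,x_R); put κ = κ_max if d is concave and κ = κ_min if d is convex. Set D = diag(d(x_1),…,d(x_M)). Then for every u ∈ ℝ^M: (κ − √2·(κ_max − κ_min)/ς_α) · uᵀGu ≤ uᵀ(−DG_α − G_αᵀD)u ≤ (κ + √2·(κ_max − κ_min)/ς_α) · uᵀGu. -/
open Matrix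

section Coefficients

variable {α : ℝ}

lemma gcoef_succ (α : ℝ) (k : ℕ) :
    gcoef α (k + 1) = (1 - (α + 1) / (k + 1 : ℕ)) * gcoef α k := rfl

lemma gcoef_nonneg (hα : α ∈ Set.Ioo (1 : ℝ) 2) (k : ℕ) : 0 ≤ gcoef α (k + 2) := by
  obtain ⟨h1, h2⟩ := hα
  induction k with
  | zero => norm_num [gcoef]; nlinarith
  | succ k ih =>
    rw [gcoef_succ]
    refine mul_nonneg ?_ ih
    rw [sub_nonneg, div_le_one (by positivity)]
    push_cast
    have : (0 : ℝ) ≤ k := k.cast_nonneg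
    linarith

lemma sum_range_gcoef (hα : α ≠ 0) (n : ℕ) :
    ∑ k ∈ Finset.range (n + 1), gcoef α k = -((n + 1) / α) * gcoef α (n + 1) := by
  induction n with
  | zero => simp [gcoef]; field_simp
  | succ n ih =>
    have : (n : ℝ) + 1 + 1 ≠ 0 := by positivity
    rw [Finset.sum_range_succ, ih, gcoef_succ α (n + 1)]
    push_cast
    field_simp
    ring

lemma sum_range_gcoef_nonpos (hα : α ∈ Set.Ioo (1 : ℝ) 2) (n : ℕ) :
    ∑ k ∈ Finset.range (n + 2), gcoef α k ≤ 0 := by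
  have := hα.1
  rw [sum_range_gcoef (by positivity)]
  exact mul_nonpos_of_nonpos_of_nonneg (neg_nonpos.2 (by positivity)) (gcoef_nonneg hα n)

lemma summable_gcoef (hα : α ∈ Set.Ioo (1 : ℝ) 2) : Summable (gcoef α) := by
  rw [← summable_nat_add_iff 2]
  refine summable_of_sum_range_le (c := α - 1) (gcoef_nonneg hα) fun n => ?_
  have := sum_range_gcoef_nonpos hα n
  rw [Finset.sum_range_succ', Finset.sum_range_succ'] at this
  have h0 : gcoef α 0 = 1 := rfl
  have h1 : gcoef α (0 + 1) = -α := by norm_num [gcoef]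
  simp only [h0, h1, add_assoc, one_add_one_eq_two] at this
  linarith

lemma wcoef_succ (α : ℝ) (k : ℕ) :
    wcoef α (k + 1) = α / 2 * gcoef α (k + 1) + (2 - α) / 2 * gcoef α k := rfl

lemma summable_wcoef (hα : α ∈ Set.Ioo (1 : ℝ) 2) : Summable (wcoef α) := by
  rw [← summable_nat_add_iff 1]
  exact (((summable_nat_add_iff 1).2 (summable_gcoef hα)).mul_left _).add
    ((summable_gcoef hα).mul_left _)

lemma wcoef_nonneg (hα : α ∈ Set.Ioo (1 : ℝ) 2) (k : ℕ) : 0 ≤ wcoef α (k + 3) := by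
  have hg := gcoef_nonneg hα k
  obtain ⟨h1, h2⟩ := hα
  have hk : (0 : ℝ) ≤ k := k.cast_nonneg
  have : wcoef α (k + 3) = (1 - α * (α + 1) / (2 * (k + 3))) * gcoef α (k + 2) := by
    rw [wcoef_succ, gcoef_succ]
    push_cast
    field_simp
    ring
  rw [this]
  refine mul_nonneg ?_ hg
  rw [sub_nonneg, div_le_one (by positivity)]
  nlinarith

lemma wcoef_zero_add_wcoef_two_nonneg (hα : α ∈ Set.Ioo (1 : ℝ) 2) :
    0 ≤ wcoef α 0 + wcoef α 2 := by
  obtain ⟨h1, h2⟩ := hα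
  have : wcoef α 0 + wcoef α 2 = α / 4 * ((α + 2) * (α - 1)) := by
    norm_num [wcoef, gcoef]; ring
  rw [this]
  have := sub_nonneg.2 h1.le
  positivity

lemma sum_range_wcoef_nonpos (hα : α ∈ Set.Ioo (1 : ℝ) 2) (n : ℕ) :
    ∑ k ∈ Finset.range (n + 3), wcoef α k ≤ 0 := by
  have h : ∑ k ∈ Finset.range (n + 3), wcoef α k
      = α / 2 * ∑ k ∈ Finset.range (n + 1 + 2), gcoef α k
        + (2 - α) / 2 * ∑ k ∈ Finset.range (n + 2), gcoef α k := by
    rw [Finset.sum_range_succ', Finset.sum_range_succ' (gcoef α) (n + 2)]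
    simp only [wcoef, Finset.sum_add_distrib, ← Finset.mul_sum]
    ring
  rw [h]
  have h1 := sum_range_gcoef_nonpos hα (n + 1)
  have h2 := sum_range_gcoef_nonpos hα n
  obtain ⟨h3, h4⟩ := hα
  exact add_nonpos (mul_nonpos_of_nonneg_of_nonpos (by linarith) h1)
    (mul_nonpos_of_nonneg_of_nonpos (by linarith) h2)

end Coefficients

section Sector

open Real in
lemma mul_sin_mul_le (a b τ : ℝ) (hb : 0 ≤ b) (hba : b ≤ a) (ha : 0 < a) (ha1 : a ≤ 1)
    (h0 : 0 ≤ τ) (hτ : τ ≤ π) : b * sin (a * τ) ≤ a * sin (b * τ) := by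
  have h := strictConcaveOn_sin_Icc.concaveOn.2 (show a * τ ∈ _ from ⟨by positivity, by nlinarith⟩)
    (show (0 : ℝ) ∈ _ from ⟨le_rfl, pi_pos.le⟩) (show 0 ≤ b / a by positivity)
    (sub_nonneg.2 ((div_le_one ha).2 hba)) (add_sub_cancel _ _)
  simp only [smul_eq_mul, sin_zero, mul_zero, add_zero] at h
  rw [show b / a * (a * τ) = b * τ by field_simp, div_mul_eq_mul_div, div_le_iff₀ ha] at h
  linarith

/-- With `a + b = 1` and `b ≤ a`, the value `a e^{2ibt} - b e^{-2iat}`, `|t| ≤ π/2`, lies in the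
sector of half-opening `bπ` around the positive real axis. -/
lemma norm_mul_cos_le_re {a b t : ℝ} (hb : 0 < b) (hba : b ≤ a) (hab : a + b = 1)
    (ht : |t| ≤ Real.pi / 2) :
    √((a * Real.cos (2 * b * t) - b * Real.cos (2 * a * t)) ^ 2
      + (a * Real.sin (2 * b * t) + b * Real.sin (2 * a * t)) ^ 2) * Real.cos (b * Real.pi)
      ≤ a * Real.cos (2 * b * t) - b * Real.cos (2 * a * t) := by
  wlog h0 : 0 ≤ t generalizing t
  · have := this (t := -t) (by rwa [abs_neg]) (by linarith)
    simp only [mul_neg, Real.cos_neg, Real.sin_neg] at this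
    refine le_trans (le_of_eq ?_) this
    congr 2
    ring
  rw [abs_of_nonneg h0] at ht
  have hpi := Real.pi_pos
  have ha : 0 < a := by linarith
  have h1 := mul_sin_mul_le a b (Real.pi - 2 * t) hb.le hba ha (by linarith) (by linarith)
    (by linarith)
  have e1 : Real.sin (a * (Real.pi - 2 * t)) = Real.sin (b * Real.pi + 2 * a * t) := by
    rw [← Real.sin_pi_sub]; congr 1; rw [show b = 1 - a by linarith]; ring
  have e2 : Real.sin (b * (Real.pi - 2 * t)) = Real.sin (b * Real.pi - 2 * b * t) := by
    congr 1; ring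
  rw [e1, e2, Real.sin_add, Real.sin_sub] at h1
  have hs : 0 < Real.sin (b * Real.pi) :=
    Real.sin_pos_of_pos_of_lt_pi (by positivity) (by nlinarith)
  have hc : 0 ≤ Real.cos (b * Real.pi) :=
    Real.cos_nonneg_of_mem_Icc ⟨by nlinarith, by nlinarith⟩
  have hs1 : 0 ≤ Real.sin (2 * b * t) :=
    Real.sin_nonneg_of_nonneg_of_le_pi (by positivity) (by nlinarith)
  have hs2 : 0 ≤ Real.sin (2 * a * t) :=
    Real.sin_nonneg_of_nonneg_of_le_pi (by positivity) (by nlinarith)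
  have hI : 0 ≤ a * Real.sin (2 * b * t) + b * Real.sin (2 * a * t) := by positivity
  set R := a * Real.cos (2 * b * t) - b * Real.cos (2 * a * t)
  set I := a * Real.sin (2 * b * t) + b * Real.sin (2 * a * t)
  have h2 : Real.cos (b * Real.pi) * I ≤ Real.sin (b * Real.pi) * R := by
    simp only [R, I]; linarith
  have h3 : 0 ≤ Real.cos (b * Real.pi) * I := by positivity
  have hR : 0 ≤ R := by
    by_contra! h
    nlinarith
  have hsc := Real.sin_sq_add_cos_sq (b * Real.pi)
  rw [← Real.sqrt_sq hc, ← Real.sqrt_mul (by positivity)]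
  refine Real.sqrt_le_iff.2 ⟨hR, ?_⟩
  have h4 := mul_self_le_mul_self h3 h2
  nlinarith

end Sector

section DiagonalDominance

open Finset

/-- A symmetric matrix with nonpositive off-diagonal entries and nonnegative row sums is positive
semidefinite. -/
lemma dotProduct_mulVec_nonneg_of_row_sum_nonneg {ι : Type*} [Fintype ι] (B : Matrix ι ι ℝ)
    (hsymm : ∀ i j, B i j = B j i) (hoff : ∀ i j, i ≠ j → B i j ≤ 0)
    (hrow : ∀ i, 0 ≤ ∑ j, B i j) (u : ι → ℝ) : 0 ≤ u ⬝ᵥ (B *ᵥ u) := by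
  have key : ∀ i j, B i j * (u i ^ 2 + u j ^ 2) / 2 ≤ u i * (B i j * u j) := by
    intro i j
    rcases eq_or_ne i j with rfl | h
    · exact le_of_eq (by ring)
    · nlinarith [mul_nonneg (neg_nonneg.2 (hoff i j h)) (sq_nonneg (u i - u j))]
  have h1 : ∑ i, ∑ j, B i j * u j ^ 2 = ∑ i, ∑ j, B i j * u i ^ 2 := by
    rw [sum_comm]
    exact sum_congr rfl fun i _ => sum_congr rfl fun j _ => by rw [hsymm]
  calc 0 ≤ ∑ i, (∑ j, B i j) * u i ^ 2 :=
        sum_nonneg fun i _ => mul_nonneg (hrow i) (sq_nonneg _)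
    _ = (∑ i, ∑ j, B i j * u i ^ 2 + ∑ i, ∑ j, B i j * u j ^ 2) / 2 := by
        rw [h1]; simp only [sum_mul]; ring
    _ = ∑ i, ∑ j, B i j * (u i ^ 2 + u j ^ 2) / 2 := by
        simp only [← sum_add_distrib, ← sum_div, mul_add]
    _ ≤ ∑ i, ∑ j, u i * (B i j * u j) := sum_le_sum fun i _ => sum_le_sum fun j _ => key i j
    _ = u ⬝ᵥ (B *ᵥ u) := by simp only [dotProduct, mulVec, mul_sum]

variable {α : ℝ} {M : ℕ}

/-- Extension by zero of a vector indexed by `Fin M` to all of `ℤ`. -/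
noncomputable def zeroExtend (y : Fin M → ℝ) (n : ℤ) : ℝ :=
  ∑ j : Fin M, if (j : ℤ) = n then y j else 0

lemma zeroExtend_coe (y : Fin M → ℝ) (j : Fin M) : zeroExtend y (j : ℕ) = y j := by
  have : ∀ i : Fin M, ((i : ℤ) = ((j : ℕ) : ℤ)) ↔ j = i := fun i => by
    rw [Nat.cast_inj, Fin.val_inj, eq_comm]
  simp [zeroExtend, this]

lemma zeroExtend_eq_zero (y : Fin M → ℝ) {n : ℤ} (hn : ∀ j : Fin M, (j : ℤ) ≠ n) :
    zeroExtend y n = 0 :=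
  sum_eq_zero fun j _ => if_neg (hn j)

lemma Gmat_mulVec_apply (y : Fin M → ℝ) (i : Fin M) :
    (Gmat α M *ᵥ y) i
      = ∑ k ∈ range (M + 3), wcoef α k * zeroExtend y (i + (1 - k)) := by
  simp only [zeroExtend, mul_sum, mulVec, dotProduct]
  rw [sum_comm]
  refine sum_congr rfl fun j _ => ?_
  simp only [Gmat, of_apply, mul_ite, mul_zero, ite_mul, zero_mul]
  split_ifs with h
  · rw [sum_eq_single ((i : ℕ) + 1 - j)]
    · rw [if_pos (by omega)]
    · intro k _ hk
      rw [if_neg (by omega)]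
    · intro hk
      exact absurd (mem_range.2 (by omega)) hk
  · refine (sum_eq_zero fun k _ => ?_).symm
    rw [if_neg (by omega)]

lemma Gmat_transpose_mulVec_apply (y : Fin M → ℝ) (i : Fin M) :
    ((Gmat α M)ᵀ *ᵥ y) i
      = ∑ k ∈ range (M + 3), wcoef α k * zeroExtend y (i - (1 - k)) := by
  simp only [zeroExtend, mul_sum, mulVec, dotProduct]
  rw [sum_comm]
  refine sum_congr rfl fun j _ => ?_
  simp only [Gmat, of_apply, transpose_apply, mul_ite, mul_zero, ite_mul, zero_mul]
  split_ifs with h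
  · rw [sum_eq_single ((j : ℕ) + 1 - i)]
    · rw [if_pos (by omega)]
    · intro k _ hk
      rw [if_neg (by omega)]
    · intro hk
      exact absurd (mem_range.2 (by omega)) hk
  · refine (sum_eq_zero fun k _ => ?_).symm
    rw [if_neg (by omega)]

lemma Gmat_add_transpose_offDiag_nonneg (hα : α ∈ Set.Ioo (1 : ℝ) 2) {i j : Fin M} (hij : i ≠ j) :
    0 ≤ Gmat α M i j + Gmat α M j i := by
  wlog h : (j : ℕ) < i generalizing i j
  · rw [add_comm]
    have hne : (i : ℕ) ≠ j := fun h => hij (Fin.ext h)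
    exact this hij.symm (by omega)
  obtain ⟨m, hm⟩ : ∃ m, (i : ℕ) = j + m + 1 := ⟨i - j - 1, by omega⟩
  simp only [Gmat, of_apply]
  rw [if_pos (by omega), show (i : ℕ) + 1 - j = m + 2 by omega]
  rcases m with _ | m
  · rw [if_pos (by omega), show (j : ℕ) + 1 - i = 0 by omega, add_comm]
    exact wcoef_zero_add_wcoef_two_nonneg hα
  · rw [if_neg (by omega), add_zero]
    exact wcoef_nonneg hα m

/-- If no symmetric second difference of the zero extension of `y` at `i` is positive, then
`(G_α + G_αᵀ) y` is nonpositive at `i`. -/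
lemma Gmat_add_transpose_mulVec_nonpos (hα : α ∈ Set.Ioo (1 : ℝ) 2) (y : Fin M → ℝ) (i : Fin M)
    (hy : 0 ≤ y i)
    (hconc : ∀ m : ℤ, zeroExtend y (i + m) + zeroExtend y (i - m) ≤ 2 * y i) :
    (Gmat α M *ᵥ y) i + ((Gmat α M)ᵀ *ᵥ y) i ≤ 0 := by
  rw [Gmat_mulVec_apply, Gmat_transpose_mulVec_apply, ← sum_add_distrib]
  simp only [← mul_add]
  have hS := sum_range_wcoef_nonpos hα M
  refine le_trans ?_ (mul_nonpos_of_nonpos_of_nonneg hS (by positivity : 0 ≤ 2 * y i))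
  rw [sum_mul, ← sub_nonneg, ← sum_sub_distrib]
  simp only [← mul_sub]
  rw [sum_range_succ', sum_range_succ', sum_range_succ']
  have h1 := hconc 1
  have h3 : 0 ≤ ∑ k ∈ range M, wcoef α (k + 1 + 1 + 1) *
      (2 * y i - (zeroExtend y (i + (1 - ((k + 1 + 1 + 1 : ℕ) : ℤ)))
        + zeroExtend y (i - (1 - ((k + 1 + 1 + 1 : ℕ) : ℤ))))) :=
    sum_nonneg fun k _ => mul_nonneg (wcoef_nonneg hα k) (sub_nonneg.2 (hconc _))
  have h0 := zeroExtend_coe y i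
  have h02 := mul_nonneg (wcoef_zero_add_wcoef_two_nonneg hα) (sub_nonneg.2 h1)
  rw [add_assoc, add_assoc]
  refine add_nonneg h3 (h02.trans_eq ?_)
  norm_num [← sub_eq_add_neg, h0]
  ring

/-- Multiplication by a discrete convex function with values in `[0, L]` is bounded by `√2 L` in
the energy seminorm of `-(G_α + G_αᵀ)`. -/
lemma energy_mul_le (hα : α ∈ Set.Ioo (1 : ℝ) 2) {L : ℝ} (e : Fin M → ℝ)
    (h0 : ∀ i, 0 ≤ e i) (hL : ∀ i, e i ≤ L)
    (hconv : ∀ i j k : Fin M, (j : ℕ) + k = 2 * i → 2 * e i ≤ e j + e k) (u : Fin M → ℝ) :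
    2 * L ^ 2 * (u ⬝ᵥ (Gmat α M *ᵥ u)) ≤ (e * u) ⬝ᵥ (Gmat α M *ᵥ (e * u)) := by
  have hee : ∀ i j, e i * e j ≤ L ^ 2 := fun i j => by
    rw [sq]; exact mul_le_mul (hL i) (hL j) (h0 j) ((h0 i).trans (hL i))
  set B : Matrix (Fin M) (Fin M) ℝ := Matrix.of fun i j =>
    -(Gmat α M i j + Gmat α M j i) * (2 * L ^ 2 - e i * e j) with hB
  have hnonneg := dotProduct_mulVec_nonneg_of_row_sum_nonneg B
    (fun i j => by simp only [hB, of_apply]; ring)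
    (fun i j hij => by
      simp only [hB, of_apply]
      nlinarith [mul_nonneg (Gmat_add_transpose_offDiag_nonneg hα hij)
        (by nlinarith [hee i j, sq_nonneg L] : 0 ≤ 2 * L ^ 2 - e i * e j)])
    (fun i => by
      have hpos : ∀ j, 0 ≤ 2 * L ^ 2 - e i * e j := fun j => by nlinarith [hee i j, sq_nonneg L]
      have := Gmat_add_transpose_mulVec_nonpos hα (fun j => 2 * L ^ 2 - e i * e j) i
        (hpos i) (fun m => by
          have hle : ∀ n : ℤ, zeroExtend (fun j => 2 * L ^ 2 - e i * e j) n ≤ 2 * L ^ 2 := by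
            intro n
            by_cases hn : ∀ j : Fin M, (j : ℤ) ≠ n
            · rw [zeroExtend_eq_zero _ hn]; positivity
            · push Not at hn
              obtain ⟨j, rfl⟩ := hn
              rw [zeroExtend_coe]
              nlinarith [mul_nonneg (h0 i) (h0 j)]
          by_cases hp : ∀ j : Fin M, (j : ℤ) ≠ i + m
          · rw [zeroExtend_eq_zero _ hp]
            nlinarith [hle (i - m), hee i i]
          by_cases hq : ∀ j : Fin M, (j : ℤ) ≠ i - m
          · rw [zeroExtend_eq_zero _ hq]
            nlinarith [hle (i + m), hee i i]
          push Not at hp hq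
          obtain ⟨j, hj⟩ := hp
          obtain ⟨k, hk⟩ := hq
          rw [← hj, ← hk, zeroExtend_coe, zeroExtend_coe]
          have := hconv i j k (by omega)
          nlinarith [h0 i])
      simp only [mulVec, dotProduct, transpose_apply, ← sum_add_distrib] at this
      simp only [hB, of_apply]
      rw [← neg_nonneg, ← sum_neg_distrib] at this
      refine this.trans (le_of_eq (sum_congr rfl fun j _ => by ring)))
    u
  have hexp : u ⬝ᵥ (B *ᵥ u) = 2 * ((e * u) ⬝ᵥ (Gmat α M *ᵥ (e * u))
      - 2 * L ^ 2 * (u ⬝ᵥ (Gmat α M *ᵥ u))) := by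
    have hcomm : ∑ i, ∑ j, u i * (Gmat α M j i * (e i * e j - 2 * L ^ 2) * u j)
        = ∑ i, ∑ j, u i * (Gmat α M i j * (e i * e j - 2 * L ^ 2) * u j) := by
      rw [sum_comm]
      exact sum_congr rfl fun i _ => sum_congr rfl fun j _ => by ring
    have h1 : u ⬝ᵥ (B *ᵥ u) = ∑ i, ∑ j, u i * (Gmat α M i j * (e i * e j - 2 * L ^ 2) * u j)
        + ∑ i, ∑ j, u i * (Gmat α M j i * (e i * e j - 2 * L ^ 2) * u j) := by
      simp only [hB, dotProduct, mulVec, mul_sum, of_apply, ← sum_add_distrib]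
      exact sum_congr rfl fun i _ => sum_congr rfl fun j _ => by ring
    rw [h1, hcomm, ← two_mul]
    congr 1
    simp only [dotProduct, mulVec, mul_sum, Pi.mul_apply, ← sum_sub_distrib]
    exact sum_congr rfl fun i _ => sum_congr rfl fun j _ => by ring
  linarith

end DiagonalDominance

section Symbol

open Complex Filter Topology MeasureTheory

variable {α : ℝ}

lemma ofReal_gcoef (α : ℝ) (k : ℕ) : (gcoef α k : ℂ) = (-1) ^ k * Ring.choose (α : ℂ) k := by
  induction k with
  | zero => simp [gcoef]
  | succ k ih =>
    have hk : (k : ℂ) + 1 ≠ 0 := by exact_mod_cast k.succ_ne_zero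
    have hk' : (k.factorial : ℂ) ≠ 0 := by exact_mod_cast k.factorial_ne_zero
    rw [Ring.choose_eq_smul] at ih ⊢
    rw [gcoef_succ, ofReal_mul, ih]
    simp only [descPochhammer_succ_right, Polynomial.smeval_mul, Polynomial.smeval_sub,
      Polynomial.smeval_X, Polynomial.smeval_natCast, pow_succ, Nat.factorial_succ, smul_eq_mul]
    push_cast
    simp
    field_simp
    ring

lemma hasSum_gcoef_of_norm_lt_one (α : ℝ) {z : ℂ} (hz : ‖z‖ < 1) :
    HasSum (fun k => (gcoef α k : ℂ) * z ^ k) ((1 - z) ^ (α : ℂ)) := by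
  have h := (one_add_cpow_hasFPowerSeriesOnBall_zero (a := α)).hasSum (y := -z)
    (by simpa [Metric.mem_eball, edist_eq_enorm_sub, ← ofReal_norm] using hz)
  simp only [zero_add, binomialSeries, FormalMultilinearSeries.ofScalars_apply_eq] at h
  rw [← sub_eq_add_neg] at h
  refine h.congr_fun fun k => ?_
  rw [ofReal_gcoef, neg_pow, smul_eq_mul]
  ring

/-- The binomial series for `(1 - z) ^ α` on the closed unit disc. -/
lemma hasSum_gcoef (hα : α ∈ Set.Ioo (1 : ℝ) 2) {z : ℂ} (hz : ‖z‖ ≤ 1) (hz1 : 1 - z ∈ slitPlane) :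
    HasSum (fun k => (gcoef α k : ℂ) * z ^ k) ((1 - z) ^ (α : ℂ)) := by
  have hev : ∀ᶠ r : ℝ in 𝓝[<] 1, r ∈ Set.Ioo (0 : ℝ) 1 := Ioo_mem_nhdsLT one_pos
  have hbd : ∀ r ∈ Set.Icc (0 : ℝ) 1, ∀ k : ℕ,
      ‖(gcoef α k : ℂ) * ((r : ℂ) * z) ^ k‖ ≤ |gcoef α k| := by
    intro r hr k
    rw [norm_mul, norm_real, Real.norm_eq_abs, norm_pow, norm_mul, norm_real, Real.norm_eq_abs,
      abs_of_nonneg hr.1]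
    exact mul_le_of_le_one_right (abs_nonneg _)
      (pow_le_one₀ (mul_nonneg hr.1 (norm_nonneg z)) (mul_le_one₀ hr.2 (norm_nonneg _) hz))
  have hlim : Tendsto (fun r : ℝ => (r : ℂ) * z) (𝓝[<] 1) (𝓝 z) := by
    have : ContinuousAt (fun r : ℝ => (r : ℂ) * z) 1 := by fun_prop
    simpa [ContinuousAt] using this.tendsto.mono_left nhdsWithin_le_nhds
  have h1 : Tendsto (fun r : ℝ => ∑' k, (gcoef α k : ℂ) * ((r : ℂ) * z) ^ k) (𝓝[<] 1)
      (𝓝 (∑' k, (gcoef α k : ℂ) * z ^ k)) :=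
    tendsto_tsum_of_dominated_convergence (summable_gcoef hα).abs
      (fun k => (hlim.pow k).const_mul _)
      (hev.mono fun r hr => hbd r ⟨hr.1.le, hr.2.le⟩)
  have h2 : Tendsto (fun r : ℝ => (1 - (r : ℂ) * z) ^ (α : ℂ)) (𝓝[<] 1)
      (𝓝 ((1 - z) ^ (α : ℂ))) :=
    (continuousAt_cpow_const hz1).tendsto.comp (hlim.const_sub 1)
  have h3 : ∑' k, (gcoef α k : ℂ) * z ^ k = (1 - z) ^ (α : ℂ) := by
    refine tendsto_nhds_unique (h1.congr' ?_) h2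
    filter_upwards [hev] with r hr
    refine (hasSum_gcoef_of_norm_lt_one α ?_).tsum_eq
    rw [norm_mul, norm_real, Real.norm_eq_abs, abs_of_pos hr.1]
    exact (mul_le_of_le_one_right hr.1.le hz).trans_lt hr.2
  rw [← h3]
  refine (Summable.of_norm_bounded (summable_gcoef hα).abs fun k => ?_).hasSum
  simpa using hbd 1 ⟨zero_le_one, le_rfl⟩ k

lemma hasSum_wcoef (hα : α ∈ Set.Ioo (1 : ℝ) 2) {z : ℂ} (hz : ‖z‖ ≤ 1) (hz1 : 1 - z ∈ slitPlane) :
    HasSum (fun k => (wcoef α k : ℂ) * z ^ k)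
      (((α / 2 : ℝ) + ((2 - α) / 2 : ℝ) * z) * (1 - z) ^ (α : ℂ)) := by
  have h := hasSum_gcoef hα hz hz1
  have h1 := h.mul_left (((2 - α) / 2 : ℝ) * z)
  have h2 : HasSum (fun k => (wcoef α k : ℂ) * z ^ k - (α / 2 : ℝ) * ((gcoef α k : ℂ) * z ^ k))
      (((2 - α) / 2 : ℝ) * z * (1 - z) ^ (α : ℂ)) := by
    rw [← hasSum_nat_add_iff' 1]
    have e : ∑ k ∈ Finset.range 1,
        ((wcoef α k : ℂ) * z ^ k - (α / 2 : ℝ) * ((gcoef α k : ℂ) * z ^ k)) = 0 := by simp [wcoef]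
    rw [e, sub_zero]
    refine h1.congr_fun fun k => ?_
    rw [wcoef_succ]
    push_cast
    ring
  rw [add_comm ((α / 2 : ℝ) : ℂ), add_mul]
  exact (h2.add (h.mul_left ((α / 2 : ℝ) : ℂ))).congr_fun fun k => by ring

/-- The symbol of the Toeplitz matrix `G_α`. -/
noncomputable def symbol (α θ : ℝ) : ℂ :=
  ∑' k : ℕ, (wcoef α k : ℂ) * exp (((k - 1 : ℤ) * θ : ℝ) * I)

lemma norm_wcoef_mul_exp (α θ : ℝ) (k : ℕ) :
    ‖(wcoef α k : ℂ) * exp (((k - 1 : ℤ) * θ : ℝ) * I)‖ = |wcoef α k| := by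
  rw [norm_mul, norm_exp_ofReal_mul_I, norm_real, Real.norm_eq_abs, mul_one]

lemma continuous_symbol (hα : α ∈ Set.Ioo (1 : ℝ) 2) : Continuous (symbol α) :=
  continuous_tsum (fun k => by fun_prop) (summable_wcoef hα).abs
    fun k θ => (norm_wcoef_mul_exp α θ k).le

lemma symbol_pi_sub (hα : α ∈ Set.Ioo (1 : ℝ) 2) {t : ℝ} (ht : |t| < Real.pi / 2) :
    symbol α (Real.pi - 2 * t) = -((2 * Real.cos t) ^ α : ℝ) *
      ((α / 2 : ℝ) * exp ((2 * ((2 - α) / 2) * t : ℝ) * I)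
        - ((2 - α) / 2 : ℝ) * exp (-(2 * (α / 2) * t : ℝ) * I)) := by
  have hcos : 0 < Real.cos t := Real.cos_pos_of_mem_Ioo (abs_lt.1 ht)
  have hz : exp ((Real.pi - 2 * t : ℝ) * I) = -exp (-(2 * t) * I) := by
    push_cast
    rw [sub_mul, sub_eq_add_neg, exp_add, exp_pi_mul_I, neg_mul]
    simp
  have hz1 : 1 - exp ((Real.pi - 2 * t : ℝ) * I) = ((2 * Real.cos t : ℝ) : ℂ) * exp (-t * I) := by
    rw [hz]
    push_cast
    rw [two_cos, add_mul, ← exp_add, ← exp_add, sub_neg_eq_add]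
    ring_nf
    simp [add_comm]
  have hslit : 1 - exp ((Real.pi - 2 * t : ℝ) * I) ∈ slitPlane := by
    left
    rw [hz1, re_ofReal_mul, ← ofReal_neg, exp_ofReal_mul_I_re, Real.cos_neg]
    positivity
  have hpow : (1 - exp ((Real.pi - 2 * t : ℝ) * I)) ^ (α : ℂ)
      = ((2 * Real.cos t) ^ α : ℝ) * exp (-(α * t) * I) := by
    have hlog : log (exp (-t * I)) = -t * I := by
      apply log_exp <;> simp <;> linarith [abs_lt.1 ht, Real.pi_pos]
    have h2cos : 0 < 2 * Real.cos t := by positivity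
    rw [hz1, cpow_def_of_ne_zero (mul_ne_zero (ofReal_ne_zero.2 h2cos.ne') (exp_ne_zero _)),
      log_ofReal_mul h2cos (exp_ne_zero _), hlog, add_mul, exp_add,
      Real.rpow_def_of_pos h2cos, ofReal_exp]
    push_cast
    ring_nf
  have hsum := (hasSum_wcoef hα (norm_exp_ofReal_mul_I (Real.pi - 2 * t)).le hslit).mul_left
    (exp (-((Real.pi - 2 * t : ℝ) * I)))
  have : symbol α (Real.pi - 2 * t) = _ := (hsum.congr_fun fun k => ?_).tsum_eq
  · have hz' : exp (-((Real.pi - 2 * t : ℝ) * I)) = -exp (2 * t * I) := by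
      rw [exp_neg, hz, inv_neg, ← exp_neg, neg_mul, neg_neg]
    have e1 : exp ((2 * ((2 - α) / 2) * t : ℝ) * I) = exp (2 * t * I) * exp (-(α * t) * I) := by
      rw [← exp_add]; congr 1; push_cast; ring
    have e2 : exp (-(2 * (α / 2) * t : ℝ) * I) = exp (-(α * t) * I) := by
      congr 1; push_cast; ring
    have e3 : exp (2 * t * I) * exp (-(2 * t) * I) = 1 := by
      rw [← exp_add, ← add_mul, add_neg_cancel, zero_mul, exp_zero]
    rw [this, hpow, hz', hz, e1, e2]
    linear_combination (((2 - α) / 2 : ℝ) * ((2 * Real.cos t) ^ α : ℝ) * exp (-(α * t) * I)) * e3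
  · rw [← exp_nat_mul, mul_left_comm, ← exp_add]
    push_cast
    ring_nf

lemma norm_symbol_mul_le (hα : α ∈ Set.Ioo (1 : ℝ) 2) {θ : ℝ} (hθ : θ ∈ Set.Ioo 0 (2 * Real.pi)) :
    ‖symbol α θ‖ * |Real.cos (α * Real.pi / 2)| ≤ -(symbol α θ).re := by
  obtain ⟨t, rfl⟩ : ∃ t, θ = Real.pi - 2 * t := ⟨(Real.pi - θ) / 2, by ring⟩
  have ht : |t| < Real.pi / 2 := abs_lt.2 ⟨by linarith [hθ.2], by linarith [hθ.1]⟩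
  have hcos : 0 < Real.cos t := Real.cos_pos_of_mem_Ioo (abs_lt.1 ht)
  have hC : 0 ≤ (2 * Real.cos t) ^ α := by positivity
  have hpi := Real.pi_pos
  have hsec := norm_mul_cos_le_re (a := α / 2) (b := (2 - α) / 2) (by linarith [hα.2])
    (by linarith [hα.1]) (by ring) ht.le
  have hς : |Real.cos (α * Real.pi / 2)| = Real.cos ((2 - α) / 2 * Real.pi) := by
    rw [show (2 - α) / 2 * Real.pi = Real.pi - α * Real.pi / 2 by ring, Real.cos_pi_sub,
      abs_of_nonpos]
    exact Real.cos_nonpos_of_pi_div_two_le_of_le (by nlinarith [hα.1]) (by nlinarith [hα.2])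
  set q : ℂ := (α / 2 : ℝ) * exp ((2 * ((2 - α) / 2) * t : ℝ) * I)
        - ((2 - α) / 2 : ℝ) * exp (-(2 * (α / 2) * t : ℝ) * I) with hq
  have hre : q.re = α / 2 * Real.cos (2 * ((2 - α) / 2) * t)
      - (2 - α) / 2 * Real.cos (2 * (α / 2) * t) := by
    rw [hq, ← ofReal_neg, sub_re, re_ofReal_mul, re_ofReal_mul, exp_ofReal_mul_I_re,
      exp_ofReal_mul_I_re, Real.cos_neg]
  have him : q.im = α / 2 * Real.sin (2 * ((2 - α) / 2) * t)
      + (2 - α) / 2 * Real.sin (2 * (α / 2) * t) := by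
    rw [hq, ← ofReal_neg, sub_im, im_ofReal_mul, im_ofReal_mul, exp_ofReal_mul_I_im,
      exp_ofReal_mul_I_im, Real.sin_neg]
    ring
  rw [← hre, ← him, ← norm_eq_sqrt_sq_add_sq] at hsec
  rw [symbol_pi_sub hα ht, ← hq, ← ofReal_neg, norm_mul, norm_real, Real.norm_eq_abs, abs_neg,
    abs_of_nonneg hC, re_ofReal_mul, hς, neg_mul, neg_neg, mul_assoc]
  exact mul_le_mul_of_nonneg_left hsec hC

lemma integral_exp_int_mul_I (n : ℤ) :
    ∫ θ in (0 : ℝ)..(2 * Real.pi), exp ((n * θ : ℝ) * I)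
      = if n = 0 then 2 * (Real.pi : ℂ) else 0 := by
  split_ifs with h
  · simp [h]
  · have hn : (n : ℂ) * I ≠ 0 := mul_ne_zero (Int.cast_ne_zero.2 h) I_ne_zero
    have := integral_exp_mul_complex (a := 0) (b := 2 * Real.pi) hn
    have e : exp ((n : ℂ) * I * (2 * Real.pi : ℝ)) = 1 := by
      rw [← exp_int_mul_two_pi_mul_I n]; congr 1; push_cast; ring
    rw [e] at this
    simp only [ofReal_zero, mul_zero, exp_zero, sub_self, zero_div] at this
    rw [← this]
    congr 1
    funext θ
    congr 1
    push_cast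
    ring

/-- The entries of `G_α` are the Fourier coefficients of its symbol. -/
lemma integral_symbol_mul_exp (hα : α ∈ Set.Ioo (1 : ℝ) 2) {M : ℕ} (i j : Fin M) :
    ∫ θ in (0 : ℝ)..(2 * Real.pi), symbol α θ * exp ((((j : ℕ) - (i : ℕ) : ℤ) * θ : ℝ) * I)
      = 2 * Real.pi * Gmat α M i j := by
  have h : HasSum (fun k : ℕ => ∫ θ in (0 : ℝ)..(2 * Real.pi),
      (wcoef α k : ℂ) * exp (((k - 1 : ℤ) * θ : ℝ) * I)
        * exp ((((j : ℕ) - (i : ℕ) : ℤ) * θ : ℝ) * I))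
      (∫ θ in (0 : ℝ)..(2 * Real.pi),
        symbol α θ * exp ((((j : ℕ) - (i : ℕ) : ℤ) * θ : ℝ) * I)) := by
    refine intervalIntegral.hasSum_integral_of_dominated_convergence (fun k _ => |wcoef α k|)
      (fun k => (Continuous.aestronglyMeasurable (by fun_prop)))
      (fun k => .of_forall fun θ _ => ?_) (.of_forall fun _ _ => (summable_wcoef hα).abs)
      intervalIntegrable_const (.of_forall fun θ _ => HasSum.mul_right _ ?_)
    · rw [norm_mul, norm_wcoef_mul_exp, norm_exp_ofReal_mul_I, mul_one]
    · exact (Summable.of_norm_bounded (summable_wcoef hα).abs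
        fun k => (norm_wcoef_mul_exp α θ k).le).hasSum
  have hterm : ∀ k : ℕ, ∫ θ in (0 : ℝ)..(2 * Real.pi),
      (wcoef α k : ℂ) * exp (((k - 1 : ℤ) * θ : ℝ) * I)
        * exp ((((j : ℕ) - (i : ℕ) : ℤ) * θ : ℝ) * I)
      = if k + (j : ℕ) = i + 1 then 2 * Real.pi * (wcoef α k : ℂ) else 0 := by
    intro k
    have e : ∀ θ : ℝ, (wcoef α k : ℂ) * exp (((k - 1 : ℤ) * θ : ℝ) * I)
        * exp ((((j : ℕ) - (i : ℕ) : ℤ) * θ : ℝ) * I)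
        = wcoef α k * exp (((k - 1 + ((j : ℕ) - (i : ℕ)) : ℤ) * θ : ℝ) * I) := by
      intro θ
      rw [mul_assoc, ← exp_add]
      congr 2
      push_cast
      ring
    simp only [e]
    rw [intervalIntegral.integral_const_mul, integral_exp_int_mul_I]
    by_cases hk : k + (j : ℕ) = i + 1
    · rw [if_pos hk, if_pos (by omega), mul_comm]
    · rw [if_neg hk, if_neg (by omega), mul_zero]
  simp only [hterm] at h
  refine h.unique ?_
  simp only [Gmat, of_apply]
  split_ifs with hij
  · convert hasSum_ite_eq ((i : ℕ) + 1 - j) (2 * Real.pi * (wcoef α ((i : ℕ) + 1 - j) : ℂ)) using 2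
      with k
    by_cases hk : k = (i : ℕ) + 1 - j
    · rw [if_pos hk, if_pos (by omega), hk]
    · rw [if_neg hk, if_neg (by omega)]
  · convert hasSum_zero using 2 with k
    · rw [if_neg (by omega)]
    · simp

/-- The trigonometric polynomial with coefficient vector `u`. -/
noncomputable def trigPoly {M : ℕ} (u : Fin M → ℝ) (θ : ℝ) : ℂ :=
  ∑ j : Fin M, u j * exp (((j : ℕ) * θ : ℝ) * I)

lemma continuous_trigPoly {M : ℕ} (u : Fin M → ℝ) : Continuous (trigPoly u) := by
  unfold trigPoly
  fun_prop

lemma integral_re_symbol_mul_trigPoly (hα : α ∈ Set.Ioo (1 : ℝ) 2) {M : ℕ} (v u : Fin M → ℝ) :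
    ∫ θ in (0 : ℝ)..(2 * Real.pi),
      (symbol α θ * (starRingEnd ℂ (trigPoly v θ) * trigPoly u θ)).re
      = 2 * Real.pi * (v ⬝ᵥ (Gmat α M *ᵥ u)) := by
  have hcont := continuous_symbol hα
  have hv := continuous_trigPoly v
  have hu := continuous_trigPoly u
  have hc : Continuous fun θ => symbol α θ * (starRingEnd ℂ (trigPoly v θ) * trigPoly u θ) := by
    fun_prop
  have hre := reCLM.intervalIntegral_comp_comm
    (hc.intervalIntegrable (μ := volume) (0 : ℝ) (2 * Real.pi))
  simp only [reCLM_apply] at hre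
  rw [hre]
  have hexp : ∀ θ : ℝ, symbol α θ * (starRingEnd ℂ (trigPoly v θ) * trigPoly u θ)
      = ∑ i : Fin M, ∑ j : Fin M, ((v i * u j : ℝ) : ℂ) *
        (symbol α θ * exp ((((j : ℕ) - (i : ℕ) : ℤ) * θ : ℝ) * I)) := by
    intro θ
    simp only [trigPoly, map_sum]
    rw [Finset.sum_mul_sum, Finset.mul_sum]
    refine Finset.sum_congr rfl fun i _ => ?_
    rw [Finset.mul_sum]
    refine Finset.sum_congr rfl fun j _ => ?_
    rw [map_mul, conj_ofReal, ← exp_conj, map_mul, conj_ofReal, conj_I]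
    have : exp ((((j : ℕ) - (i : ℕ) : ℤ) * θ : ℝ) * I)
        = exp (((i : ℕ) * θ : ℝ) * -I) * exp (((j : ℕ) * θ : ℝ) * I) := by
      rw [← exp_add]; congr 1; push_cast; ring
    rw [this, ofReal_mul (v i) (u j)]
    ring
  simp only [hexp]
  rw [intervalIntegral.integral_finsetSum (μ := volume) fun i _ =>
    Continuous.intervalIntegrable (by fun_prop) _ _]
  simp only [dotProduct, mulVec, Finset.mul_sum, re_sum]
  refine Finset.sum_congr rfl fun i _ => ?_
  rw [intervalIntegral.integral_finsetSum (μ := volume) fun j _ =>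
    Continuous.intervalIntegrable (by fun_prop) _ _, re_sum]
  refine Finset.sum_congr rfl fun j _ => ?_
  rw [intervalIntegral.integral_const_mul, integral_symbol_mul_exp hα]
  rw [re_ofReal_mul, ← ofReal_ofNat, ← ofReal_mul, ← ofReal_mul, ofReal_re]
  ring

/-- The bilinear form of `G_α` is sectorial with half-opening `(2 - α) π / 2`. -/
lemma abs_cos_mul_dotProduct_le (hα : α ∈ Set.Ioo (1 : ℝ) 2) {M : ℕ} (v u : Fin M → ℝ) {s : ℝ}
    (hs : 0 < s) :
    2 * s * |Real.cos (α * Real.pi / 2)| * (v ⬝ᵥ (Gmat α M *ᵥ u))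
      ≤ -(v ⬝ᵥ (Gmat α M *ᵥ v)) - s ^ 2 * (u ⬝ᵥ (Gmat α M *ᵥ u)) := by
  have hcont := continuous_symbol hα
  have hv := continuous_trigPoly v
  have hu := continuous_trigPoly u
  set ς := |Real.cos (α * Real.pi / 2)|
  have hς : 0 ≤ ς := abs_nonneg _
  have h := intervalIntegral.integral_mono_on_of_le_Ioo (a := 0) (b := 2 * Real.pi) (μ := volume)
    (f := fun θ => 2 * s * ς * (symbol α θ * (starRingEnd ℂ (trigPoly v θ) * trigPoly u θ)).re)
    (g := fun θ => -(symbol α θ * (starRingEnd ℂ (trigPoly v θ) * trigPoly v θ)).re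
      - s ^ 2 * (symbol α θ * (starRingEnd ℂ (trigPoly u θ) * trigPoly u θ)).re)
    (by positivity)
    (Continuous.intervalIntegrable (by fun_prop) _ _)
    (Continuous.intervalIntegrable (by fun_prop) _ _)
    (fun θ hθ => by
      have hsec := norm_symbol_mul_le hα hθ
      have h1 := re_le_norm (symbol α θ * (starRingEnd ℂ (trigPoly v θ) * trigPoly u θ))
      rw [norm_mul, norm_mul, norm_conj] at h1
      have h2 : ∀ w : ℂ, (symbol α θ * (starRingEnd ℂ w * w)).re = (symbol α θ).re * ‖w‖ ^ 2 := by
        intro w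
        rw [conj_mul', ← ofReal_pow, re_mul_ofReal]
      simp only [h2]
      set V := ‖trigPoly v θ‖
      set U := ‖trigPoly u θ‖
      have hV : 0 ≤ V := norm_nonneg _
      have hU : 0 ≤ U := norm_nonneg _
      have h3 : 0 ≤ -(symbol α θ).re := le_trans (by positivity) hsec
      have h4 := mul_le_mul_of_nonneg_left h1 (by positivity : 0 ≤ 2 * s * ς)
      have h5 := mul_le_mul_of_nonneg_right hsec (by positivity : 0 ≤ 2 * s * (V * U))
      have h6 := mul_nonneg h3 (sq_nonneg (V - s * U))
      nlinarith)
  rw [intervalIntegral.integral_const_mul, intervalIntegral.integral_sub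
    (Continuous.intervalIntegrable (by fun_prop) _ _)
    (Continuous.intervalIntegrable (by fun_prop) _ _), intervalIntegral.integral_neg,
    intervalIntegral.integral_const_mul, integral_re_symbol_mul_trigPoly hα,
    integral_re_symbol_mul_trigPoly hα, integral_re_symbol_mul_trigPoly hα] at h
  have hpi := Real.two_pi_pos
  refine le_of_mul_le_mul_left ?_ hpi
  linarith

end Symbol

section KeyEstimate

variable {α : ℝ} {M : ℕ}

/-- Weighting by a discrete convex function with values in `[0, L]` is a relatively bounded
perturbation of the bilinear form of `G_α`. -/
lemma abs_dotProduct_mul_mulVec_le (hα : α ∈ Set.Ioo (1 : ℝ) 2) {L : ℝ} (hL0 : 0 ≤ L)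
    (e : Fin M → ℝ) (h0 : ∀ i, 0 ≤ e i) (hL : ∀ i, e i ≤ L)
    (hconv : ∀ i j k : Fin M, (j : ℕ) + k = 2 * i → 2 * e i ≤ e j + e k) (u : Fin M → ℝ) :
    |(e * u) ⬝ᵥ (Gmat α M *ᵥ u)|
      ≤ √2 * L / |Real.cos (α * Real.pi / 2)| * -(u ⬝ᵥ (Gmat α M *ᵥ u)) := by
  rcases hL0.eq_or_lt with rfl | hLpos
  · have he : e = 0 := funext fun i => le_antisymm (hL i) (h0 i)
    simp [he]
  have hς : 0 < |Real.cos (α * Real.pi / 2)| := by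
    rw [abs_pos]
    have hpi := Real.pi_pos
    exact (Real.cos_neg_of_pi_div_two_lt_of_lt (by nlinarith [hα.1]) (by nlinarith [hα.2])).ne
  have hs : 0 < √2 * L := by positivity
  have hs2 : (√2 * L) ^ 2 = 2 * L ^ 2 := by rw [mul_pow, Real.sq_sqrt zero_le_two]
  have hE := energy_mul_le hα e h0 hL hconv u
  rw [← hs2] at hE
  have h1 := abs_cos_mul_dotProduct_le hα (e * u) u hs
  have h2 := abs_cos_mul_dotProduct_le hα (-(e * u)) u hs
  simp only [neg_dotProduct, mulVec_neg, dotProduct_neg, neg_neg] at h2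
  set ς := |Real.cos (α * Real.pi / 2)|
  set s := √2 * L
  set P := u ⬝ᵥ (Gmat α M *ᵥ u)
  set R := (e * u) ⬝ᵥ (Gmat α M *ᵥ u)
  rw [div_mul_eq_mul_div, le_div_iff₀ hς, ← abs_of_pos hς, ← abs_mul, abs_le]
  constructor <;> refine le_of_mul_le_mul_left ?_ (by positivity : 0 < 2 * s) <;> nlinarith

end KeyEstimate

/-- Theorem 2.3 (key estimate): under boundedness and concavity/convexity of `d`,
`(κ − √2(κ_max−κ_min)/ς_α) uᵀGu ≤ uᵀ(−DG_α − G_αᵀD)u ≤ (κ + √2(κ_max−κ_min)/ς_α) uᵀGu`. -/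
theorem key_estimate (α : ℝ) (hα : α ∈ Set.Ioo (1 : ℝ) 2)
    (xL xR : ℝ) (hx : xL < xR) (M : ℕ) (hM : 0 < M) (d : ℝ → ℝ)
    (κmin κmax κ : ℝ) (hκmin : 0 ≤ κmin)
    (hbound : ∀ x ∈ Set.Ioo xL xR, κmin ≤ d x ∧ d x ≤ κmax)
    (hκ : (ConcaveOn ℝ (Set.Ioo xL xR) d ∧ κ = κmax) ∨
          (ConvexOn ℝ (Set.Ioo xL xR) d ∧ κ = κmin))
    (u : Fin M → ℝ) :
    let h := (xR - xL) / (M + 1)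
    let X : Fin M → ℝ := fun i => xL + ((i : ℕ) + 1) * h
    let D : Matrix (Fin M) (Fin M) ℝ := Matrix.diagonal fun i => d (X i)
    let G : Matrix (Fin M) (Fin M) ℝ := -(Gmat α M) - (Gmat α M)ᵀ
    (κ - Real.sqrt 2 * (κmax - κmin) / |Real.cos (α * Real.pi / 2)|) * (u ⬝ᵥ (G *ᵥ u)) ≤
        u ⬝ᵥ ((-(D * Gmat α M) - (Gmat α M)ᵀ * D) *ᵥ u) ∧
      u ⬝ᵥ ((-(D * Gmat α M) - (Gmat α M)ᵀ * D) *ᵥ u) ≤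
        (κ + Real.sqrt 2 * (κmax - κmin) / |Real.cos (α * Real.pi / 2)|) * (u ⬝ᵥ (G *ᵥ u)) := by
  intro h X D G
  have hMpos : (0 : ℝ) < M + 1 := by positivity
  have hh : 0 < h := div_pos (sub_pos.2 hx) hMpos
  have hXmem : ∀ i, X i ∈ Set.Ioo xL xR := by
    intro i
    have hi : ((i : ℕ) : ℝ) + 1 < M + 1 := by exact_mod_cast Nat.succ_lt_succ i.2
    have hMh : (M + 1 : ℝ) * h = xR - xL := mul_div_cancel₀ _ hMpos.ne'
    have := mul_lt_mul_of_pos_right hi hh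
    exact ⟨lt_add_of_pos_right _ (by positivity), by simp only [X]; linarith⟩
  have hmid : ∀ i j k : Fin M, (j : ℕ) + k = 2 * i →
      (1 / 2 : ℝ) • X j + (1 / 2 : ℝ) • X k = X i := by
    intro i j k hjk
    have : ((j : ℕ) : ℝ) + (k : ℕ) = 2 * (i : ℕ) := by exact_mod_cast hjk
    simp only [X, smul_eq_mul]
    linear_combination h / 2 * this
  have hκle : 0 ≤ κmax - κmin := by
    have := hbound _ (hXmem ⟨0, hM⟩)
    linarith
  set w : Fin M → ℝ := fun i => d (X i)
  have hG : u ⬝ᵥ (G *ᵥ u) = -2 * (u ⬝ᵥ (Gmat α M *ᵥ u)) := by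
    simp only [G, sub_mulVec, neg_mulVec, dotProduct_sub, dotProduct_neg]
    rw [dotProduct_mulVec u (Gmat α M)ᵀ, vecMul_transpose, dotProduct_comm (Gmat α M *ᵥ u)]
    ring
  have hDu : D *ᵥ u = w * u := funext fun i => by simp [D, w, mulVec_diagonal]
  have hD : u ⬝ᵥ ((-(D * Gmat α M) - (Gmat α M)ᵀ * D) *ᵥ u)
      = -2 * ((w * u) ⬝ᵥ (Gmat α M *ᵥ u)) := by
    simp only [sub_mulVec, neg_mulVec, dotProduct_sub, dotProduct_neg, ← mulVec_mulVec, hDu]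
    rw [dotProduct_mulVec u (Gmat α M)ᵀ, vecMul_transpose, dotProduct_comm (Gmat α M *ᵥ u),
      dotProduct_mulVec u D, ← mulVec_transpose, diagonal_transpose, hDu]
    ring
  rw [hG, hD]
  rcases hκ with ⟨hd, rfl⟩ | ⟨hd, rfl⟩
  · have key := abs_le.1 <| abs_dotProduct_mul_mulVec_le hα hκle (fun i => κ - w i)
      (fun i => by linarith [hbound _ (hXmem i)]) (fun i => by linarith [hbound _ (hXmem i)])
      (fun i j k hjk => by
        have := hd.2 (hXmem j) (hXmem k) (by norm_num : (0 : ℝ) ≤ 1 / 2)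
          (by norm_num : (0 : ℝ) ≤ 1 / 2) (by norm_num)
        rw [hmid i j k hjk, smul_eq_mul, smul_eq_mul] at this
        linarith) u
    have hw : (fun i => κ - w i) * u = κ • u - w * u := by
      funext i; simp [sub_mul]
    rw [hw, sub_dotProduct, smul_dotProduct, smul_eq_mul] at key
    constructor <;> linarith
  · have key := abs_le.1 <| abs_dotProduct_mul_mulVec_le hα hκle (fun i => w i - κ)
      (fun i => by linarith [hbound _ (hXmem i)]) (fun i => by linarith [hbound _ (hXmem i)])
      (fun i j k hjk => by
        have := hd.2 (hXmem j) (hXmem k) (by norm_num : (0 : ℝ) ≤ 1 / 2)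
          (by norm_num : (0 : ℝ) ≤ 1 / 2) (by norm_num)
        rw [hmid i j k hjk, smul_eq_mul, smul_eq_mul] at this
        linarith) u
    have hw : (fun i => w i - κ) * u = w * u - κ • u := by
      funext i; simp [sub_mul]
    rw [hw, sub_dotProduct, smul_dotProduct, smul_eq_mul] at key
    constructor <;> linarith
end
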